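/- Let (δ_k)_{k∈ℤ} be a bounded sequence of real numbers. If integers m and m' both satisfy the averaged perturbation condition — that is, there exist N ∈ ℕ and ε > 0 with sup_{n∈ℤ} |(1/N) ∑_{k=n+1}^{n+N} δ_k + m| ≤ 1/2 − ε, and there exist N' ∈ ℕ and ε' > 0 with sup_{n∈ℤ} |(1/N') ∑_{k=n+1}^{n+N'} δ_k + m'| ≤ 1/2 − ε' — then m = m'. -/

import Mathlib

/-- A uniform bound on the shifted averages over windows of length `N` passes to windows whose
length is a multiple of `N`. -/
theorem abs_sum_range_mul_add_le (δ : ℤ → ℝ) {N : ℕ} (hN : 0 < N) {c r : ℝ}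
    (h : ∀ n : ℤ, |(1 / (N : ℝ)) * ∑ k ∈ Finset.range N, δ (n + 1 + (k : ℤ)) + c| ≤ r)
    (M : ℕ) (n : ℤ) :
    |∑ k ∈ Finset.range (N * M), δ (n + 1 + (k : ℤ)) + N * M * c| ≤ N * M * r := by
  have hN' : (0 : ℝ) < N := by exact_mod_cast hN
  have window (n : ℤ) : |∑ k ∈ Finset.range N, δ (n + 1 + (k : ℤ)) + N * c| ≤ N * r := by
    have key := mul_le_mul_of_nonneg_left (h n) hN'.le
    rw [← abs_of_pos hN', ← abs_mul, abs_of_pos hN', mul_add, ← mul_assoc,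
      mul_one_div_cancel hN'.ne', one_mul] at key
    exact key
  induction M with
  | zero => simp
  | succ M ih =>
    have last := window (n + (N * M : ℕ))
    have shift : ∑ k ∈ Finset.range N, δ (n + 1 + ((N * M + k : ℕ) : ℤ)) =
        ∑ k ∈ Finset.range N, δ (n + (N * M : ℕ) + 1 + (k : ℤ)) :=
      Finset.sum_congr rfl fun k _ => by congr 1; push_cast; ring
    rw [Nat.mul_succ, Finset.sum_range_add, shift]
    rw [abs_le] at ih last ⊢
    push_cast at ih last ⊢
    constructor <;> linarith [ih.1, ih.2, last.1, last.2]

/-- Uniqueness of the integer shift `m` in the averaged perturbation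
condition for a bounded sequence `(δ_k)_{k ∈ ℤ}`. -/
theorem shift_unique (δ : ℤ → ℝ) (hb : ∃ B : ℝ, ∀ k, |δ k| ≤ B) (m m' : ℤ)
    (h : ∃ N : ℕ, 0 < N ∧ ∃ ε : ℝ, 0 < ε ∧ ∀ n : ℤ,
      |(1 / (N : ℝ)) * ∑ k ∈ Finset.range N, δ (n + 1 + (k : ℤ)) + (m : ℝ)| ≤ 1 / 2 - ε)
    (h' : ∃ N' : ℕ, 0 < N' ∧ ∃ ε' : ℝ, 0 < ε' ∧ ∀ n : ℤ,
      |(1 / (N' : ℝ)) * ∑ k ∈ Finset.range N', δ (n + 1 + (k : ℤ)) + (m' : ℝ)| ≤ 1 / 2 - ε') :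
    m = m' := by
  obtain ⟨N, hN, ε, hε, h⟩ := h
  obtain ⟨N', hN', ε', hε', h'⟩ := h'
  have bound := abs_le.1 (abs_sum_range_mul_add_le δ hN h N' 0)
  have bound' := abs_le.1 (abs_sum_range_mul_add_le δ hN' h' N 0)
  rw [mul_comm N' N, mul_comm (N' : ℝ) N] at bound'
  have hpos : (0 : ℝ) < N * N' := by positivity
  have upper : (m : ℝ) - m' ≤ 1 - ε - ε' :=
    le_of_mul_le_mul_left (by linarith [bound.2, bound'.1]) hpos
  have lower : (m' : ℝ) - m ≤ 1 - ε - ε' :=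
    le_of_mul_le_mul_left (by linarith [bound.1, bound'.2]) hpos
  have lt : m < m' + 1 := by
    have : (m : ℝ) < m' + 1 := by linarith
    exact_mod_cast this
  have lt' : m' < m + 1 := by
    have : (m' : ℝ) < m + 1 := by linarith
    exact_mod_cast this
  omega
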